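/- arXiv:2411.09244 — 2 statements merged into one kernel-verified Lean document; each statement's English description precedes it below -/
import Mathlib

section
/- Let E be a real normed vector space, let N ≥ 1 be an integer, Δt > 0, and let C₁, C₂ ≥ 0. Let F, G : ℕ → E → E be propagators satisfying, for all n < N and all u, v ∈ E: (i) ‖G n u − G n v‖ ≤ (1 + C₁Δt)·‖u − v‖ (Lipschitz continuity of the coarse solver), and (ii) ‖(F n u − G n u) − (F n v − G n v)‖ ≤ C₂·Δt²·‖u − v‖ (first-order accuracy of the coarse solver relative to the fine solver). Let U : ℕ → E be the exact trajectory defined by U(n+1) = F n (U n), and define the parareal iterates u : ℕ → ℕ → E by: u 0 0 = U 0 and u 0 (n+1) = G n (u 0 n) (zeroth iterate from the coarse solver), and for each k, u (k+1) 0 = U 0 and u (k+1) (n+1) = G n (u (k+1) n) + F n (u k n) − G n (u k n). Then for every k ≥ 0 and every n ≤ N, ‖U n − u k n‖ ≤ (C₂Δt²)^k · C(n,k) · (1 + C₁Δt)^(n−k) · E₀, where C(n,k) is the binomial coefficient and E₀ = max over m ≤ N of ‖U m − u 0 m‖. -/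
/-- A doubly indexed sequence vanishing at `n = 0` for `k ≥ 1`, bounded by `M` for `k = 0` and
satisfying a Pascal-type recursive inequality grows at most binomially. -/
theorem le_choose_of_pascal_recursion {N : ℕ} {a b M : ℝ} (ha : 1 ≤ a) (hb : 0 ≤ b) (hM : 0 ≤ M)
    {e : ℕ → ℕ → ℝ} (h0 : ∀ n ≤ N, e 0 n ≤ M) (hk0 : ∀ k, e (k + 1) 0 ≤ 0)
    (hrec : ∀ k, ∀ n < N, e (k + 1) (n + 1) ≤ a * e (k + 1) n + b * e k n) (k : ℕ) :
    ∀ n ≤ N, e k n ≤ b ^ k * (n.choose k : ℝ) * a ^ (n - k) * M := by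
  induction k with
  | zero =>
    intro n hn
    simpa using (h0 n hn).trans (le_mul_of_one_le_left hM (one_le_pow₀ ha))
  | succ k ihk =>
    intro n
    induction n with
    | zero => intro _; simpa using hk0 k
    | succ n ihn =>
      intro hn
      have ha0 : 0 ≤ a := zero_le_one.trans ha
      have hpow : a * ((n.choose (k + 1) : ℝ) * a ^ (n - (k + 1))) =
          (n.choose (k + 1) : ℝ) * a ^ (n - k) := by
        rcases lt_or_ge n (k + 1) with h | h
        · simp [Nat.choose_eq_zero_of_lt h]
        · rw [show n - k = n - (k + 1) + 1 by omega, pow_succ]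
          ring
      calc e (k + 1) (n + 1) ≤ a * e (k + 1) n + b * e k n := hrec k n hn
        _ ≤ a * (b ^ (k + 1) * (n.choose (k + 1) : ℝ) * a ^ (n - (k + 1)) * M) +
            b * (b ^ k * (n.choose k : ℝ) * a ^ (n - k) * M) := by
          gcongr
          · exact ihn (by omega)
          · exact ihk n (by omega)
        _ = b ^ (k + 1) * M * (a * ((n.choose (k + 1) : ℝ) * a ^ (n - (k + 1)))) +
            b ^ (k + 1) * M * ((n.choose k : ℝ) * a ^ (n - k)) := by ring
        _ = b ^ (k + 1) * ((n + 1).choose (k + 1) : ℝ) * a ^ (n + 1 - (k + 1)) * M := by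
          rw [hpow, Nat.choose_succ_succ, Nat.add_sub_add_right]
          push_cast
          ring

/-- Convergence of the parareal iteration: with a Lipschitz coarse solver `G` and a
fine solver `F` such that `F - G` is first-order small, the error of the `k`-th
parareal iterate at time step `n ≤ N` is bounded by
`(C₂Δt²)^k · C(n,k) · (1 + C₁Δt)^(n-k) · E₀`. -/
theorem parareal_convergence
    {E : Type*} [NormedAddCommGroup E] [NormedSpace ℝ E]
    (N : ℕ) (hN : 1 ≤ N) (Δt C₁ C₂ : ℝ) (hΔt : 0 < Δt) (hC₁ : 0 ≤ C₁) (hC₂ : 0 ≤ C₂)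
    (F G : ℕ → E → E)
    (hG : ∀ n < N, ∀ u v : E, ‖G n u - G n v‖ ≤ (1 + C₁ * Δt) * ‖u - v‖)
    (hFG : ∀ n < N, ∀ u v : E,
      ‖(F n u - G n u) - (F n v - G n v)‖ ≤ C₂ * Δt ^ 2 * ‖u - v‖)
    (U : ℕ → E) (hU : ∀ n, U (n + 1) = F n (U n))
    (u : ℕ → ℕ → E)
    (hu00 : u 0 0 = U 0)
    (hu0succ : ∀ n, u 0 (n + 1) = G n (u 0 n))
    (huk0 : ∀ k, u (k + 1) 0 = U 0)
    (huksucc : ∀ k n, u (k + 1) (n + 1) = G n (u (k + 1) n) + F n (u k n) - G n (u k n)) :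
    ∀ k, ∀ n ≤ N,
      ‖U n - u k n‖ ≤ (C₂ * Δt ^ 2) ^ k * (n.choose k : ℝ) * (1 + C₁ * Δt) ^ (n - k) *
        ((Finset.range (N + 1)).sup' (by simp) fun m => ‖U m - u 0 m‖) := by
  have hle : ∀ n ≤ N, ‖U n - u 0 n‖ ≤
      (Finset.range (N + 1)).sup' (by simp) fun m => ‖U m - u 0 m‖ := fun n hn =>
    Finset.le_sup' (fun m => ‖U m - u 0 m‖) (Finset.mem_range.2 (Nat.lt_succ_of_le hn))
  refine le_choose_of_pascal_recursion (e := fun k n => ‖U n - u k n‖)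
    (le_add_of_nonneg_right (by positivity)) (by positivity)
    ((norm_nonneg _).trans (hle 0 N.zero_le)) hle (fun k => by simp [huk0]) fun k n hn => ?_
  have hsplit : U (n + 1) - u (k + 1) (n + 1) = (G n (U n) - G n (u (k + 1) n)) +
      ((F n (U n) - G n (U n)) - (F n (u k n) - G n (u k n))) := by
    rw [hU, huksucc]
    abel
  simp only [hsplit]
  exact (norm_add_le _ _).trans (add_le_add (hG n hn _ _) (hFG n hn _ _))
end

section
/- Let N be a natural number, β ≥ 1, ε ≥ 0, M ≥ 0, and let e : ℕ → ℕ → ℝ be a doubly indexed family of nonnegative real numbers such that: (i) e k 0 = 0 for all k ≥ 1; (ii) e (k+1) (n+1) ≤ β · e (k+1) n + ε · e k n for all k ≥ 0 and n ≥ 0; and (iii) e 0 n ≤ M for all n ≤ N. Then for all k ≥ 0 and all n ≤ N, e k n ≤ ε^k · C(n,k) · β^(n−k) · M, where C(n,k) denotes the binomial coefficient. -/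
/-- The double-index recurrence lemma behind the parareal convergence proof:
if `e k 0 = 0` for `k ≥ 1`, `e (k+1) (n+1) ≤ β e (k+1) n + ε e k n`, and
`e 0 n ≤ M` for `n ≤ N`, then `e k n ≤ ε^k C(n,k) β^(n-k) M` for `n ≤ N`. -/
theorem parareal_recurrence_bound
    (N : ℕ) (β ε M : ℝ) (hβ : 1 ≤ β) (hε : 0 ≤ ε) (hM : 0 ≤ M)
    (e : ℕ → ℕ → ℝ) (he_nonneg : ∀ k n, 0 ≤ e k n)
    (h1 : ∀ k, 1 ≤ k → e k 0 = 0)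
    (h2 : ∀ k n, e (k + 1) (n + 1) ≤ β * e (k + 1) n + ε * e k n)
    (h3 : ∀ n ≤ N, e 0 n ≤ M) :
    ∀ k, ∀ n ≤ N, e k n ≤ ε ^ k * (n.choose k : ℝ) * β ^ (n - k) * M := by
  intro k
  induction k with
  | zero =>
    intro n hn
    simpa using (h3 n hn).trans (le_mul_of_one_le_left hM (one_le_pow₀ hβ))
  | succ k ihk =>
    intro n
    induction n with
    | zero => simp [h1 (k + 1)]
    | succ n ihn =>
      intro hn
      have hβ0 : 0 ≤ β := zero_le_one.trans hβ
      have hpow : β * ((n.choose (k + 1) : ℝ) * β ^ (n - (k + 1))) =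
          n.choose (k + 1) * β ^ (n - k) := by
        rcases Nat.lt_or_ge n (k + 1) with h | h
        · simp [Nat.choose_eq_zero_of_lt h]
        · rw [show n - k = n - (k + 1) + 1 by omega, pow_succ]
          ring
      calc e (k + 1) (n + 1) ≤ β * e (k + 1) n + ε * e k n := h2 k n
        _ ≤ β * (ε ^ (k + 1) * (n.choose (k + 1) : ℝ) * β ^ (n - (k + 1)) * M) +
            ε * (ε ^ k * (n.choose k : ℝ) * β ^ (n - k) * M) := by
          gcongr
          · exact ihn (by omega)
          · exact ihk n (by omega)
        _ = ε ^ (k + 1) * ((n + 1).choose (k + 1) : ℝ) * β ^ (n + 1 - (k + 1)) * M := by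
          rw [Nat.add_sub_add_right, Nat.choose_succ_succ']
          push_cast
          linear_combination ε ^ (k + 1) * M * hpow
end
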